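/- Let T ≥ 1 be an integer. If ρ̂(G, M) < n^{−1/(2T)}, then the lifted system S(G_T, M^T) admits a quadratic Lyapunov multinorm, i.e. a family of symmetric positive definite matrices (Q_v)_{v ∈ V} and a constant 0 < γ < 1 such that A_eᵀ Q_j A_e ⪯ γ² Q_i in the Loewner order for every edge e of G_T from v_i to v_j with associated matrix A_e. -/

import Mathlib

open Filter Matrix

/-- The operator norm on `n × n` real matrices induced by the Euclidean norm on `ℝ^n`. -/
noncomputable def euclOpNorm {n : ℕ} (A : Matrix (Fin n) (Fin n) ℝ) : ℝ :=
  ‖LinearMap.toContinuousLinearMap (Matrix.toEuclideanLin A)‖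

/-- The Euclidean norm on `ℝ^n`. -/
noncomputable def euclNorm {n : ℕ} (x : Fin n → ℝ) : ℝ :=
  Real.sqrt (∑ i, x i ^ 2)

/-- The matrix product `A_{σ(t-1)} ⋯ A_{σ(0)}` associated to a sequence of labels `σ`. -/
noncomputable def pathProd {n N : ℕ} (A : Fin N → Matrix (Fin n) (Fin n) ℝ)
    (t : ℕ) (σ : Fin t → Fin N) : Matrix (Fin n) (Fin n) ℝ :=
  (List.ofFn fun i => A (σ i)).reverse.prod

/-- `v, σ` describe a path of length `t` in the labeled graph with edge set `E`:
its `i`-th edge goes from node `v i` to node `v (i+1)` and carries the label `σ i`. -/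
def IsPath {V : Type*} {N : ℕ} (E : Set (V × V × Fin N)) {t : ℕ}
    (v : Fin (t + 1) → V) (σ : Fin t → Fin N) : Prop :=
  ∀ i : Fin t, (v i.castSucc, v i.succ, σ i) ∈ E

/-- The labeled graph with edge set `E` is strongly connected: any node can be joined to
any node by a path of length at least 1. -/
def StronglyConnected {V : Type*} {N : ℕ} (E : Set (V × V × Fin N)) : Prop :=
  ∀ u w : V, ∃ (t : ℕ) (v : Fin (t + 1) → V) (σ : Fin t → Fin N),
    1 ≤ t ∧ IsPath E v σ ∧ v 0 = u ∧ v (Fin.last t) = w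

/-- The constrained joint spectral radius of the system `S(G, M)` with `G = (V, E)`, `M = A`. -/
noncomputable def cjsr {V : Type*} {n N : ℕ} (E : Set (V × V × Fin N))
    (A : Fin N → Matrix (Fin n) (Fin n) ℝ) : ℝ :=
  Filter.atTop.limsup fun t : ℕ =>
    sSup { x : ℝ | ∃ (v : Fin (t + 1) → V) (σ : Fin t → Fin N),
      IsPath E v σ ∧ x = euclOpNorm (pathProd A t σ) ^ (1 / (t : ℝ)) }

/-- The constrained joint spectral radius of the `T`-lifted system `S(G_T, M^T)`:
paths of length `k` in `G_T` are exactly paths of length `k * T` in `G`. -/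
noncomputable def cjsrLift {V : Type*} {n N : ℕ} (E : Set (V × V × Fin N))
    (A : Fin N → Matrix (Fin n) (Fin n) ℝ) (T : ℕ) : ℝ :=
  Filter.atTop.limsup fun k : ℕ =>
    sSup { x : ℝ | ∃ (v : Fin (k * T + 1) → V) (σ : Fin (k * T) → Fin N),
      IsPath E v σ ∧ x = euclOpNorm (pathProd A (k * T) σ) ^ (1 / (k : ℝ)) }

/-- Stability of the constrained switching system: along every infinite path of the graph,
every trajectory converges to `0`. -/
def Stable {V : Type*} {n N : ℕ} (E : Set (V × V × Fin N))
    (A : Fin N → Matrix (Fin n) (Fin n) ℝ) : Prop :=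
  ∀ (v : ℕ → V) (σ : ℕ → Fin N), (∀ t : ℕ, (v t, v (t + 1), σ t) ∈ E) →
    ∀ x0 : Fin n → ℝ,
      Tendsto (fun t : ℕ => (pathProd A t fun i : Fin t => σ i).mulVec x0)
        atTop (nhds 0)

/-- `ν` is a family of norms on `ℝ^n` indexed by the nodes. -/
def IsNormFamily {V : Type*} {n : ℕ} (ν : V → (Fin n → ℝ) → ℝ) : Prop :=
  ∀ u : V,
    (∀ x y : Fin n → ℝ, ν u (x + y) ≤ ν u x + ν u y) ∧
    (∀ (a : ℝ) (x : Fin n → ℝ), ν u (a • x) = |a| * ν u x) ∧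
    (∀ x : Fin n → ℝ, ν u x = 0 → x = 0)

/-- `ν` is a `γ`-multinorm for the system `S(G, M)`. -/
def IsMultinorm {V : Type*} {n N : ℕ} (E : Set (V × V × Fin N))
    (A : Fin N → Matrix (Fin n) (Fin n) ℝ) (γ : ℝ)
    (ν : V → (Fin n → ℝ) → ℝ) : Prop :=
  IsNormFamily ν ∧
    ∀ vi vj : V, ∀ σ : Fin N, (vi, vj, σ) ∈ E →
      ∀ x : Fin n → ℝ, ν vj ((A σ).mulVec x) ≤ γ * ν vi x

/-- `Q` is a quadratic `γ`-multinorm for the system `S(G, M)`. -/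
def IsQuadMultinorm {V : Type*} {n N : ℕ} (E : Set (V × V × Fin N))
    (A : Fin N → Matrix (Fin n) (Fin n) ℝ) (γ : ℝ)
    (Q : V → Matrix (Fin n) (Fin n) ℝ) : Prop :=
  (∀ u : V, (Q u).PosDef) ∧
    ∀ vi vj : V, ∀ σ : Fin N, (vi, vj, σ) ∈ E →
      (γ ^ 2 • Q vi - (A σ)ᵀ * Q vj * A σ).PosSemidef

/-- `Q` is a quadratic `γ`-multinorm for the lifted system `S(G_T, M^T)`: the Loewner
inequality holds along every path of length `T` of `G` (i.e. every edge of `G_T`). -/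
def IsQuadMultinormLift {V : Type*} {n N : ℕ} (E : Set (V × V × Fin N))
    (A : Fin N → Matrix (Fin n) (Fin n) ℝ) (T : ℕ) (γ : ℝ)
    (Q : V → Matrix (Fin n) (Fin n) ℝ) : Prop :=
  (∀ u : V, (Q u).PosDef) ∧
    ∀ (v : Fin (T + 1) → V) (σ : Fin T → Fin N), IsPath E v σ →
      (γ ^ 2 • Q (v 0) -
        (pathProd A T σ)ᵀ * Q (v (Fin.last T)) * pathProd A T σ).PosSemidef

/-- `Q` is a path-dependent Lyapunov function with memory `T` for `S(G, M)`:
one positive definite quadratic form per path of length `T`, with a strict decrease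
condition along every path of length `T + 1`. -/
def IsPathDepLyap {V : Type*} {n N : ℕ} (E : Set (V × V × Fin N))
    (A : Fin N → Matrix (Fin n) (Fin n) ℝ) (T : ℕ)
    (Q : (Fin (T + 1) → V) → (Fin T → Fin N) → Matrix (Fin n) (Fin n) ℝ) : Prop :=
  (∀ (v : Fin (T + 1) → V) (σ : Fin T → Fin N), IsPath E v σ → (Q v σ).PosDef) ∧
    ∀ (v : Fin (T + 2) → V) (σ : Fin (T + 1) → Fin N), IsPath E v σ →
      (Q (fun i : Fin (T + 1) => v i.castSucc) (fun i : Fin T => σ i.castSucc) -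
        (A (σ (Fin.last T)))ᵀ *
          Q (fun i : Fin (T + 1) => v i.succ) (fun i : Fin T => σ i.succ) *
            A (σ (Fin.last T))).PosDef

/-- The joint spectral radius of a finite set of matrices (arbitrary switching). -/
noncomputable def jsr {n N : ℕ} (A : Fin N → Matrix (Fin n) (Fin n) ℝ) : ℝ :=
  Filter.atTop.limsup fun t : ℕ =>
    sSup { x : ℝ | ∃ σ : Fin t → Fin N,
      x = euclOpNorm (pathProd A t σ) ^ (1 / (t : ℝ)) }

/-- The joint spectral radius of the set `M^T` of all products of `T` matrices from `M`:
products of `k` matrices from `M^T` are exactly products of `k * T` matrices from `M`. -/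
noncomputable def jsrPow {n N : ℕ} (A : Fin N → Matrix (Fin n) (Fin n) ℝ) (T : ℕ) : ℝ :=
  Filter.atTop.limsup fun k : ℕ =>
    sSup { x : ℝ | ∃ σ : Fin (k * T) → Fin N,
      x = euclOpNorm (pathProd A (k * T) σ) ^ (1 / (k : ℝ)) }

/-- The optimal value `γ*(G, M)` of the semidefinite program of Corollary 4.6. -/
noncomputable def gammaStar {V : Type*} {n N : ℕ} (E : Set (V × V × Fin N))
    (A : Fin N → Matrix (Fin n) (Fin n) ℝ) : ℝ :=
  sInf {γ : ℝ | 0 < γ ∧ ∃ Q : V → Matrix (Fin n) (Fin n) ℝ,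
    (∀ u : V, (Q u).PosDef) ∧ ∀ vi vj : V, ∀ σ : Fin N, (vi, vj, σ) ∈ E →
      (γ ^ 2 • Q vi - (A σ)ᵀ * Q vj * A σ).PosDef}

/-- The optimal value `γ*(G_T, M^T)` of the semidefinite program applied to the lifted
system `S(G_T, M^T)`. -/
noncomputable def gammaStarLift {V : Type*} {n N : ℕ} (E : Set (V × V × Fin N))
    (A : Fin N → Matrix (Fin n) (Fin n) ℝ) (T : ℕ) : ℝ :=
  sInf {γ : ℝ | 0 < γ ∧ ∃ Q : V → Matrix (Fin n) (Fin n) ℝ,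
    (∀ u : V, (Q u).PosDef) ∧
      ∀ (v : Fin (T + 1) → V) (σ : Fin T → Fin N), IsPath E v σ →
        (γ ^ 2 • Q (v 0) -
          (pathProd A T σ)ᵀ * Q (v (Fin.last T)) * pathProd A T σ).PosDef}


open scoped Matrix.Norms.L2Operator MatrixOrder

lemma aux_psd_factor {n : ℕ} {Y : Matrix (Fin n) (Fin n) ℝ} (hY : Y.PosSemidef) :
    ∃ Z : Matrix (Fin n) (Fin n) ℝ, Y = Zᵀ * Z := by
  obtain ⟨Z, hZ⟩ := CStarAlgebra.nonneg_iff_eq_star_mul_self.mp hY.nonneg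
  exact ⟨Z, by simpa [Matrix.star_eq_conjTranspose, conjTranspose_eq_transpose_of_trivial] using hZ⟩

lemma aux_closed {n : ℕ} : IsClosed {X : Matrix (Fin n) (Fin n) ℝ | 0 ≤ X} := by
  have : {X : Matrix (Fin n) (Fin n) ℝ | 0 ≤ X} =
      {X | Xᴴ = X} ∩ ⋂ x : Fin n → ℝ, {X | 0 ≤ star x ⬝ᵥ (X *ᵥ x)} := by
    ext X
    simp only [Set.mem_setOf_eq, Set.mem_inter_iff, Set.mem_iInter]
    rw [nonneg_iff_posSemidef, posSemidef_iff_dotProduct_mulVec]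
    rfl
  rw [this]
  refine (isClosed_eq (by fun_prop) continuous_id).inter (isClosed_iInter fun x => ?_)
  exact isClosed_le continuous_const (by fun_prop)

/-- a PSD matrix is bounded by its trace -/
lemma aux_trace {n : ℕ} {Y : Matrix (Fin n) (Fin n) ℝ} (hY : Y.PosSemidef) (c : ℝ)
    (hc : Y.trace ≤ c) : (c • (1 : Matrix (Fin n) (Fin n) ℝ) - Y).PosSemidef := by
  refine PosSemidef.of_dotProduct_mulVec_nonneg ?_ ?_
  · refine IsHermitian.sub ?_ hY.1
    simp [IsHermitian]
  · intro x
    obtain ⟨Z, rfl⟩ := aux_psd_factor hY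
    have h1 : star x ⬝ᵥ ((Zᵀ * Z) *ᵥ x) = ∑ i, (∑ j, Z i j * x j) ^ 2 := by
      rw [← mulVec_mulVec, dotProduct_mulVec, vecMul_transpose]
      simp [dotProduct, mulVec, pow_two]
    have h2 : (Zᵀ * Z).trace = ∑ i, ∑ j, Z i j ^ 2 := by
      rw [Finset.sum_comm]
      simp [trace, Matrix.mul_apply, pow_two]
    have h3 : ∑ i, (∑ j, Z i j * x j) ^ 2 ≤ (∑ i, ∑ j, Z i j ^ 2) * ∑ j, x j ^ 2 := by
      rw [Finset.sum_mul]
      exact Finset.sum_le_sum fun i _ => Finset.sum_mul_sq_le_sq_mul_sq _ _ _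
    have h4 : star x ⬝ᵥ x = ∑ j, x j ^ 2 := by simp [dotProduct, pow_two]
    rw [sub_mulVec, dotProduct_sub, h1, smul_mulVec, one_mulVec, dotProduct_smul, h4, smul_eq_mul]
    have : (0:ℝ) ≤ ∑ j, x j ^ 2 := by positivity
    rw [h2] at hc
    nlinarith [mul_le_mul_of_nonneg_right hc this]

/-- first-order optimality for the determinant -/
lemma aux_trace_nonpos {n : ℕ} (M : Matrix (Fin n) (Fin n) ℝ)
    (h : ∀ s : ℝ, 0 < s → s < 1 → (1 + s • M).det ≤ 1) : M.trace ≤ 0 := by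
  set g := (det (1 + (Polynomial.X : Polynomial ℝ) • M.map Polynomial.C)).divX.divX with hg
  have hle : ∀ s : ℝ, 0 < s → s < 1 → M.trace + g.eval s * s ≤ 0 := by
    intro s hs hs1
    have h1 := h s hs hs1
    rw [det_one_add_smul, ← hg] at h1
    have : s * (M.trace + g.eval s * s) ≤ 0 := by nlinarith
    by_contra hcon
    push Not at hcon
    nlinarith [mul_pos hs hcon]
  have hcont : Continuous fun s : ℝ => M.trace + g.eval s * s := by fun_prop
  have ht : Tendsto (fun s : ℝ => M.trace + g.eval s * s) (nhdsWithin 0 (Set.Ioi 0)) (nhds (M.trace)) := by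
    have := (hcont.tendsto 0).mono_left (nhdsWithin_le_nhds (s := Set.Ioi 0))
    simpa using this
  refine le_of_tendsto ht ?_
  filter_upwards [Ioo_mem_nhdsGT (zero_lt_one' ℝ)] with s hs
  exact hle s hs.1 hs.2

/-- The maximal determinant element of a compact convex set of PSD matrices containing `1`. -/
lemma aux_max {n : ℕ} (C : Set (Matrix (Fin n) (Fin n) ℝ)) (hC : IsCompact C)
    (hconv : Convex ℝ C) (hpsd : ∀ X ∈ C, X.PosSemidef) (h1 : 1 ∈ C) :
    ∃ P ∈ C, P.PosDef ∧ ∀ X ∈ C, ((n : ℝ) • P - X).PosSemidef := by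
  obtain ⟨P, hP, hmax⟩ := hC.exists_isMaxOn ⟨1, h1⟩
    (f := fun X : Matrix (Fin n) (Fin n) ℝ => X.det) (Continuous.continuousOn (by fun_prop))
  have hdet : 1 ≤ P.det := by simpa using hmax h1
  have hPD : P.PosDef := (hpsd P hP).posDef_iff_det_ne_zero.mpr (by positivity)
  refine ⟨P, hP, hPD, fun X hX => ?_⟩
  obtain ⟨L, hL⟩ := aux_psd_factor (hpsd P hP)
  have hLdet : IsUnit L.det := by
    have : P.det ≠ 0 := by positivity
    rw [hL, det_mul] at this
    exact isUnit_iff_ne_zero.mpr (right_ne_zero_of_mul this)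
  have hLT : IsUnit (Lᵀ).det := by simpa using hLdet
  set K := L⁻¹ with hK
  have hLK : L * K = 1 := mul_nonsing_inv _ hLdet
  have hKL : K * L = 1 := nonsing_inv_mul _ hLdet
  have hKL' : Lᵀ * Kᵀ = 1 := by rw [← transpose_mul, hKL, transpose_one]
  set Y := Kᵀ * X * K with hY
  have hXY : X = Lᵀ * Y * L := by
    calc X = (Lᵀ * Kᵀ) * X * (K * L) := by rw [hKL, hKL']; simp
      _ = _ := by simp only [hY, Matrix.mul_assoc]
  have hYpsd : Y.PosSemidef := by
    have := (hpsd X hX).conjTranspose_mul_mul_same K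
    rwa [conjTranspose_eq_transpose_of_trivial] at this
  have htr : (Y - 1).trace ≤ 0 := by
    apply aux_trace_nonpos
    intro s hs hs1
    have hmem : (1 - s) • P + s • X ∈ C := hconv hP hX (by linarith) hs.le (by ring)
    have h2 : ((1 - s) • P + s • X).det ≤ P.det := hmax hmem
    have h3 : (1 - s) • P + s • X = Lᵀ * (1 + s • (Y - 1)) * L := by
      rw [hXY, hL]
      simp only [Matrix.mul_add, Matrix.add_mul, Matrix.mul_sub, Matrix.sub_mul, Matrix.mul_smul, Matrix.smul_mul, Matrix.mul_one, smul_sub, sub_smul, one_smul]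
      abel
    have h4 : P.det = Lᵀ.det * L.det := by rw [hL, det_mul]
    rw [h3, det_mul, det_mul] at h2
    have h5 : (1 + s • (Y - 1)).det * P.det ≤ 1 * P.det := by
      rw [one_mul]
      calc _ = Lᵀ.det * (1 + s • (Y - 1)).det * L.det := by rw [h4]; ring
        _ ≤ _ := h2
    exact le_of_mul_le_mul_right h5 (by positivity)
  rw [trace_sub, trace_one, Fintype.card_fin] at htr
  have h6 := (aux_trace hYpsd n (by linarith)).conjTranspose_mul_mul_same L
  rw [conjTranspose_eq_transpose_of_trivial] at h6
  convert h6 using 1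
  rw [hXY, hL]
  simp only [Matrix.mul_sub, Matrix.sub_mul, Matrix.mul_smul, Matrix.smul_mul, Matrix.mul_one]

/-- `R v t B`: `B` is the product along a path of length `t` starting at `v`. -/
inductive AuxR {V : Type} {n N : ℕ} (E : Set (V × V × Fin N))
    (A : Fin N → Matrix (Fin n) (Fin n) ℝ) : V → ℕ → Matrix (Fin n) (Fin n) ℝ → Prop
  | nil (v : V) : AuxR E A v 0 1
  | cons (v w : V) (l : Fin N) (t : ℕ) (B : Matrix (Fin n) (Fin n) ℝ) :
      (v, w, l) ∈ E → AuxR E A w t B → AuxR E A v (t + 1) (B * A l)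

lemma pathProd_zero' {n N : ℕ} (A : Fin N → Matrix (Fin n) (Fin n) ℝ) (σ : Fin 0 → Fin N) :
    pathProd A 0 σ = 1 := by simp [pathProd]

lemma pathProd_succ' {n N : ℕ} (A : Fin N → Matrix (Fin n) (Fin n) ℝ) (t : ℕ)
    (σ : Fin (t + 1) → Fin N) :
    pathProd A (t + 1) σ = pathProd A t (fun i => σ i.succ) * A (σ 0) := by
  simp [pathProd, List.ofFn_succ]

lemma AuxR.exists_path {V : Type} {n N : ℕ} {E : Set (V × V × Fin N)}
    {A : Fin N → Matrix (Fin n) (Fin n) ℝ} {v : V} {t : ℕ} {B : Matrix (Fin n) (Fin n) ℝ}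
    (h : AuxR E A v t B) : ∃ (p : Fin (t + 1) → V) (σ : Fin t → Fin N), IsPath E p σ ∧
      p 0 = v ∧ B = pathProd A t σ := by
  induction h with
  | nil v => exact ⟨fun _ => v, Fin.elim0, fun i => i.elim0, rfl, by rw [pathProd_zero']⟩
  | cons v w l t B he _ ih =>
    obtain ⟨p, σ, hp, h0, hB⟩ := ih
    refine ⟨Fin.cons v p, Fin.cons l σ, ?_, rfl, ?_⟩
    · intro i
      refine Fin.cases ?_ (fun i => ?_) i
      · simpa [h0] using he
      · simpa [← Fin.succ_castSucc] using hp i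
    · rw [pathProd_succ', hB]; simp

lemma AuxR.concat {V : Type} {n N : ℕ} {E : Set (V × V × Fin N)}
    {A : Fin N → Matrix (Fin n) (Fin n) ℝ} {t : ℕ} {B : Matrix (Fin n) (Fin n) ℝ} (T : ℕ) :
    ∀ (p : Fin (T + 1) → V) (σ : Fin T → Fin N), IsPath E p σ →
    AuxR E A (p (Fin.last T)) t B → AuxR E A (p 0) (t + T) (B * pathProd A T σ) := by
  induction T with
  | zero => intro p σ _ h; simpa [pathProd_zero'] using h
  | succ T ih =>
    intro p σ hp h
    have := ih (fun i => p i.succ) (fun i => σ i.succ) (fun i => by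
      simpa [← Fin.succ_castSucc] using hp i.succ) (by simpa using h)
    rw [pathProd_succ', ← Matrix.mul_assoc, ← Nat.add_assoc]
    exact AuxR.cons _ _ _ _ _ (by simpa using hp 0) this

lemma pathProd_norm_le {n N : ℕ} (hn : 1 ≤ n) (A : Fin N → Matrix (Fin n) (Fin n) ℝ) (a : ℝ)
    (ha : ∀ i, ‖A i‖ ≤ a) (ha1 : 1 ≤ a) (t : ℕ) :
    ∀ σ : Fin t → Fin N, ‖pathProd A t σ‖ ≤ a ^ t := by
  induction t with
  | zero =>
    intro σ
    have : Nonempty (Fin n) := ⟨⟨0, hn⟩⟩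
    simp [pathProd_zero']
  | succ t ih =>
    intro σ
    rw [pathProd_succ', pow_succ]
    exact (norm_mul_le _ _).trans (mul_le_mul (ih _) (ha _) (norm_nonneg _) (by positivity))

lemma aux_bound {n N : ℕ} (hn : 1 ≤ n)
    {V : Type} [Fintype V] (E : Set (V × V × Fin N)) (A : Fin N → Matrix (Fin n) (Fin n) ℝ)
    (c : ℝ) (hc : 0 < c) (hρ : cjsr E A < c) :
    ∃ K : ℝ, 0 < K ∧ ∀ (t : ℕ) (v : Fin (t + 1) → V) (σ : Fin t → Fin N), IsPath E v σ →
      ‖pathProd A t σ‖ ≤ K * c ^ t := by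
  obtain ⟨a, ha1, ha⟩ : ∃ a : ℝ, 1 ≤ a ∧ ∀ i, ‖A i‖ ≤ a := by
    refine ⟨1 + ∑ i, ‖A i‖, by have : 0 ≤ ∑ i, ‖A i‖ := by positivity
                               linarith, fun i => ?_⟩
    have := Finset.single_le_sum (f := fun i => ‖A i‖) (fun i _ => norm_nonneg _) (Finset.mem_univ i)
    linarith
  have hb := pathProd_norm_le hn A a ha ha1
  have hopn : ∀ B : Matrix (Fin n) (Fin n) ℝ, euclOpNorm B = ‖B‖ := fun B => rfl
  unfold cjsr at hρ
  have hev := eventually_lt_of_limsup_lt hρ (by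
    refine isBoundedUnder_of_eventually_le (a := a) ?_
    filter_upwards [eventually_ge_atTop 1] with t ht
    refine Real.sSup_le ?_ (by linarith)
    rintro x ⟨v, σ, -, rfl⟩
    rw [hopn]
    calc ‖pathProd A t σ‖ ^ (1 / (t:ℝ)) ≤ (a ^ t) ^ (1 / (t:ℝ)) :=
          Real.rpow_le_rpow (norm_nonneg _) (hb t σ) (by positivity)
      _ = a := by rw [one_div, Real.pow_rpow_inv_natCast (by linarith) (by omega)])
  obtain ⟨t0, ht0⟩ := eventually_atTop.mp (hev.and (eventually_ge_atTop 1))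
  have hac : 0 < a / c := by positivity
  refine ⟨1 + ∑ s ∈ Finset.range t0, (a / c) ^ s, by positivity, fun t v σ hp => ?_⟩
  have hS : 0 ≤ ∑ s ∈ Finset.range t0, (a / c) ^ s := by positivity
  by_cases h : t0 ≤ t
  · obtain ⟨h1, h2⟩ := ht0 t h
    have h3 : ‖pathProd A t σ‖ ^ (1 / (t:ℝ)) ≤ c := by
      refine le_trans (le_csSup (s := { x : ℝ | ∃ (v : Fin (t + 1) → V) (σ : Fin t → Fin N),
        IsPath E v σ ∧ x = euclOpNorm (pathProd A t σ) ^ (1 / (t : ℝ)) })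
        (Set.Finite.bddAbove ?_) ⟨v, σ, hp, by rw [hopn]⟩) h1.le
      refine (Set.finite_range (fun q : (Fin (t+1) → V) × (Fin t → Fin N) =>
        euclOpNorm (pathProd A t q.2) ^ (1 / (t:ℝ)))).subset ?_
      rintro x ⟨v, σ, -, rfl⟩
      exact ⟨(v, σ), rfl⟩
    have h4 : ‖pathProd A t σ‖ ≤ c ^ t := by
      calc _ = (‖pathProd A t σ‖ ^ (1 / (t:ℝ))) ^ t := by
            rw [one_div, Real.rpow_inv_natCast_pow (norm_nonneg _) (by omega)]
        _ ≤ c ^ t := pow_le_pow_left₀ (by positivity) h3 t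
    have : 0 < c ^ t := by positivity
    nlinarith [mul_nonneg hS this.le]
  · have h5 : (a / c) ^ t ≤ ∑ s ∈ Finset.range t0, (a / c) ^ s :=
      Finset.single_le_sum (f := fun s => (a / c) ^ s) (fun i _ => by positivity)
        (Finset.mem_range.mpr (by omega))
    have : 0 < c ^ t := by positivity
    calc _ ≤ a ^ t := hb t σ
      _ = (a / c) ^ t * c ^ t := by rw [div_pow]; field_simp
      _ ≤ _ := by gcongr; linarith

theorem exists_quad_lyapunov_multinorm_lift {n N : ℕ} (hn : 1 ≤ n) (hN : 1 ≤ N)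
    {V : Type} [Fintype V] [Nonempty V]
    (E : Set (V × V × Fin N)) (A : Fin N → Matrix (Fin n) (Fin n) ℝ)
    (hconn : StronglyConnected E)
    (T : ℕ) (hT : 1 ≤ T)
    (hρ : cjsr E A < (n : ℝ) ^ (-1 / (2 * (T : ℝ)))) :
    ∃ γ : ℝ, 0 < γ ∧ γ < 1 ∧
      ∃ Q : V → Matrix (Fin n) (Fin n) ℝ, IsQuadMultinormLift E A T γ Q := by
  have hn0 : (0:ℝ) < n := by exact_mod_cast hn
  have hT0 : (0:ℝ) < T := by exact_mod_cast hT
  obtain ⟨c, hc1, hc2⟩ := exists_between (max_lt hρ (Real.rpow_pos_of_pos hn0 _) :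
    max (cjsr E A) 0 < (n : ℝ) ^ (-1 / (2 * (T : ℝ))))
  have hc : 0 < c := (le_max_right _ _).trans_lt hc1
  obtain ⟨K, hK, hbd⟩ := aux_bound hn E A c hc ((le_max_left _ _).trans_lt hc1)
  have hcT : c ^ (2 * T) * n < 1 := by
    have h1 : c ^ (2 * T) < ((n : ℝ) ^ (-1 / (2 * (T : ℝ)))) ^ (2 * T) :=
      pow_lt_pow_left₀ hc2 hc.le (by omega)
    rw [← Real.rpow_natCast ((n : ℝ) ^ (-1 / (2 * (T : ℝ)))), ← Real.rpow_mul hn0.le] at h1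
    have h2 : -1 / (2 * (T : ℝ)) * ((2 * T : ℕ) : ℝ) = -1 := by push_cast; field_simp
    rw [h2, Real.rpow_neg_one] at h1
    calc _ < (n:ℝ)⁻¹ * n := by gcongr
      _ = 1 := inv_mul_cancel₀ hn0.ne'
  have hγsq : (Real.sqrt (c ^ (2 * T) * n)) ^ 2 = c ^ (2 * T) * n := Real.sq_sqrt (by positivity)
  let S : V → Set (Matrix (Fin n) (Fin n) ℝ) := fun v =>
    {X | ∃ t B, AuxR E A v t B ∧ X = (c ^ (2 * t))⁻¹ • (Bᵀ * B)}
  let C : V → Set (Matrix (Fin n) (Fin n) ℝ) := fun v => closure (convexHull ℝ (S v))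
  have hconv : ∀ v, Convex ℝ (C v) := fun v => (convex_convexHull ℝ _).closure
  have hSC : ∀ v, S v ⊆ C v := fun v => (subset_convexHull ℝ _).trans subset_closure
  have hcomp : ∀ v, IsCompact (C v) := by
    intro v
    have : ProperSpace (Matrix (Fin n) (Fin n) ℝ) := FiniteDimensional.proper ℝ _
    refine (isCompact_closedBall (0 : Matrix (Fin n) (Fin n) ℝ) (K ^ 2)).of_isClosed_subset isClosed_closure ?_
    refine closure_minimal (convexHull_min ?_ (convex_closedBall _ _)) Metric.isClosed_closedBall
    rintro X ⟨t, B, hB, rfl⟩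
    obtain ⟨p, σ, hp, -, rfl⟩ := hB.exists_path
    have h1 := hbd t p σ hp
    rw [mem_closedBall_zero_iff, norm_smul, ← conjTranspose_eq_transpose_of_trivial,
      l2_opNorm_conjTranspose_mul_self, norm_inv, Real.norm_of_nonneg (by positivity),
      inv_mul_le_iff₀ (by positivity)]
    calc _ ≤ (K * c ^ t) * (K * c ^ t) := mul_self_le_mul_self (norm_nonneg _) h1
      _ = _ := by ring
  have hpsd : ∀ v, ∀ X ∈ C v, X.PosSemidef := by
    intro v X hX
    have hset : C v ⊆ {X : Matrix (Fin n) (Fin n) ℝ | 0 ≤ X} := by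
      refine closure_minimal (convexHull_min ?_ (convex_Ici (𝕜 := ℝ) 0)) ?_
      swap
      · exact aux_closed
      rintro X ⟨t, B, hB, rfl⟩
      have := (posSemidef_conjTranspose_mul_self B).smul
        (show (0:ℝ) ≤ (c ^ (2 * t))⁻¹ by positivity)
      rw [conjTranspose_eq_transpose_of_trivial] at this
      exact this.nonneg
    exact (hset hX : (0 : Matrix (Fin n) (Fin n) ℝ) ≤ X).posSemidef
  have hone : ∀ v, 1 ∈ C v := fun v => hSC v ⟨0, 1, AuxR.nil v, by simp⟩
  choose Q hQC hQ hQmax using fun v => aux_max (C v) (hcomp v) (hconv v) (hpsd v) (hone v)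
  refine ⟨Real.sqrt (c ^ (2 * T) * n), Real.sqrt_pos.mpr (by positivity), ?_, Q, hQ, ?_⟩
  · rw [Real.sqrt_lt' one_pos]; simpa using hcT
  intro p σ hp
  set B := pathProd A T σ with hB
  have hmem : (c ^ (2 * T))⁻¹ • (Bᵀ * Q (p (Fin.last T)) * B) ∈ C (p 0) := by
    let f : Matrix (Fin n) (Fin n) ℝ →ₗ[ℝ] Matrix (Fin n) (Fin n) ℝ :=
      { toFun := fun X => (c ^ (2 * T))⁻¹ • (Bᵀ * X * B)
        map_add' := by intro X Y; simp [Matrix.mul_add, Matrix.add_mul]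
        map_smul' := by intro a X; simp [smul_comm a] }
    have hf : Continuous f := f.continuous_of_finiteDimensional
    have h1 : f '' C (p (Fin.last T)) ⊆ C (p 0) := by
      refine (image_closure_subset_closure_image hf).trans (closure_mono ?_)
      rw [f.image_convexHull]
      refine convexHull_mono ?_
      rintro _ ⟨X, ⟨t, D, hD, rfl⟩, rfl⟩
      refine ⟨t + T, D * B, AuxR.concat T p σ hp hD, ?_⟩
      change (c ^ (2 * T))⁻¹ • (Bᵀ * ((c ^ (2 * t))⁻¹ • (Dᵀ * D)) * B) = _
      rw [Matrix.mul_smul, Matrix.smul_mul, smul_smul, transpose_mul, ← mul_inv, ← pow_add]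
      simp only [Matrix.mul_assoc]
      congr 3
      ring
    exact h1 ⟨_, hQC _, rfl⟩
  have h2 := (hQmax (p 0) _ hmem).smul (show (0:ℝ) ≤ c ^ (2 * T) by positivity)
  rw [hγsq]
  convert h2 using 1
  rw [smul_sub, smul_smul, smul_smul, mul_inv_cancel₀ (by positivity), one_smul]
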